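/- (Helicity lemma.) Let n ≥ 2, r > 0, and let φ be a symplectic embedding of an open neighborhood of the sphere S_r^{2n−1} into ℝ^{2n}. Set S = φ(S_r^{2n−1}). Then every bounded connected component D of ℝ^{2n} \ S satisfies vol(D) = vol(B_r) = π^n r^{2n} / n!. -/

import Mathlib

open Metric Set MeasureTheory Real Filter Topology Bornology
open scoped ContDiff ENNReal

noncomputable section

/-- `ℝ^{2n}` with the Euclidean structure. -/
abbrev R2n (n : ℕ) := EuclideanSpace ℝ (Fin (2 * n))

/-- The standard symplectic form `ω_st = Σ dx_i ∧ dy_i` on `ℝ^{2n}`,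
evaluated on a pair of (tangent) vectors. -/
def sympForm (n : ℕ) (v w : R2n n) : ℝ :=
  ∑ i : Fin n,
    (v ⟨2 * i.1, by have := i.isLt; omega⟩ * w ⟨2 * i.1 + 1, by have := i.isLt; omega⟩ -
      v ⟨2 * i.1 + 1, by have := i.isLt; omega⟩ * w ⟨2 * i.1, by have := i.isLt; omega⟩)

/-- `φ` is a symplectic embedding of the open set `N ⊆ ℝ^{2n}` into `U ⊆ ℝ^{2n}`:
a smooth injective map on `N` with image in `U` whose derivative preserves `ω_st`. -/
def IsSympEmbOn (n : ℕ) (N U : Set (R2n n)) (φ : R2n n → R2n n) : Prop :=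
  IsOpen N ∧ ContDiffOn ℝ ∞ φ N ∧ InjOn φ N ∧ MapsTo φ N U ∧
    ∀ p ∈ N, ∀ v w : R2n n,
      sympForm n (fderiv ℝ φ p v) (fderiv ℝ φ p w) = sympForm n v w

/-- A symplectic embedding of (a neighbourhood of) an arbitrary set `A ⊆ ℝ^{2n}` into `U`. -/
def SympEmbNbhd (n : ℕ) (A U : Set (R2n n)) : Prop :=
  ∃ N φ, A ⊆ N ∧ IsSympEmbOn n N U φ

/-- The spherical capacity `s(U)`. -/
def sphericalCap (n : ℕ) (U : Set (R2n n)) : ℝ≥0∞ :=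
  sSup {c : ℝ≥0∞ | ∃ r : ℝ, 0 < r ∧ c = ENNReal.ofReal (π * r ^ 2) ∧
    SympEmbNbhd n (sphere (0 : R2n n) r) U}

/-- The quadratic form defining the ellipsoid with symplectic half axes `a i`. -/
def ellQ (n : ℕ) (a : Fin n → ℝ) (z : R2n n) : ℝ :=
  ∑ i : Fin n,
    ((z ⟨2 * i.1, by have := i.isLt; omega⟩) ^ 2 +
      (z ⟨2 * i.1 + 1, by have := i.isLt; omega⟩) ^ 2) / (a i) ^ 2

/-- The open ellipsoid `E(a 0, …, a (n-1)) ⊆ ℝ^{2n}`. -/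
def ellipsoid (n : ℕ) (a : Fin n → ℝ) : Set (R2n n) := {z | ellQ n a z < 1}

/-- The boundary `∂E(a 0, …, a (n-1)) ⊆ ℝ^{2n}` of an ellipsoid. -/
def ellipsoidBdry (n : ℕ) (a : Fin n → ℝ) : Set (R2n n) := {z | ellQ n a z = 1}

/-- The ellipsoidal shell `U_ε = (1+ε)E \ closure((1-ε)E)`. -/
def ellShell (n : ℕ) (a : Fin n → ℝ) (ε : ℝ) : Set (R2n n) :=
  ellipsoid n (fun i => (1 + ε) * a i) \ closure (ellipsoid n (fun i => (1 - ε) * a i))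

/-- The `δ`-shell capacity `c_δ(U)`, defined via embeddings of the closed
shells `r A_δ = closure(B_r) \ B_{r(1-δ)}`. -/
def shellCap (n : ℕ) (δ : ℝ) (U : Set (R2n n)) : ℝ≥0∞ :=
  sSup {c : ℝ≥0∞ | ∃ r : ℝ, 0 < r ∧ c = ENNReal.ofReal (π * r ^ 2) ∧
    SympEmbNbhd n (closedBall (0 : R2n n) r \ ball 0 (r * (1 - δ))) U}

/-- The ellipsoidal capacity `e(U)`: the supremum of `π r₁²` over symplectic embeddings of
boundaries of ellipsoids with half axes `r₁ ≤ … ≤ r_n` (here `r₁ = ⨅ i, a i`). -/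
def ellipsoidalCap (n : ℕ) (U : Set (R2n n)) : ℝ≥0∞ :=
  sSup {c : ℝ≥0∞ | ∃ a : Fin n → ℝ, (∀ i, 0 < a i) ∧ Monotone a ∧
    c = ENNReal.ofReal (π * (⨅ i, a i) ^ 2) ∧ SympEmbNbhd n (ellipsoidBdry n a) U}

/-- The Gromov radius `c_B(U)`. -/
def gromovRadius (n : ℕ) (U : Set (R2n n)) : ℝ≥0∞ :=
  sSup {c : ℝ≥0∞ | ∃ r : ℝ, 0 < r ∧ c = ENNReal.ofReal (π * r ^ 2) ∧
    ∃ φ, IsSympEmbOn n (ball (0 : R2n n) r) U φ}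


section Integration

variable {ι : Type*} [Fintype ι] [DecidableEq ι]

/-- Integration by parts against a linear vector field. -/
theorem integral_fderiv_apply_clm {f : EuclideanSpace ℝ ι → ℝ} (hf : ContDiff ℝ 1 f)
    (hc : HasCompactSupport f) (B : EuclideanSpace ℝ ι →L[ℝ] EuclideanSpace ℝ ι) :
    ∫ z, fderiv ℝ f z (B z) =
      -((∑ j, B (EuclideanSpace.single j 1) j) * ∫ z, f z) := by
  have hdf : Continuous (fderiv ℝ f) := hf.continuous_fderiv one_ne_zero
  have hcd : HasCompactSupport (fderiv ℝ f) := hc.fderiv ℝ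
  have hBj : ∀ j (z : EuclideanSpace ℝ ι), HasFDerivAt (fun z => B z j)
      ((EuclideanSpace.proj (𝕜 := ℝ) j).comp B) z := fun j z =>
    ((EuclideanSpace.proj (𝕜 := ℝ) j).comp B).hasFDerivAt
  have hfB : ∀ j (z : EuclideanSpace ℝ ι), fderiv ℝ (fun z => B z j) z
      (EuclideanSpace.single j 1) = B (EuclideanSpace.single j 1) j := fun j z => by
    rw [(hBj j z).fderiv]; simp
  have hBc : ∀ j, Continuous fun z : EuclideanSpace ℝ ι => B z j := fun j =>
    ((EuclideanSpace.proj (𝕜 := ℝ) j).comp B).continuous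
  have hint : ∀ j, Integrable fun z : EuclideanSpace ℝ ι =>
      B z j * fderiv ℝ f z (EuclideanSpace.single j 1) := fun j => by
    refine Continuous.integrable_of_hasCompactSupport (by fun_prop) ?_
    refine hcd.mono fun z hz => ?_
    contrapose! hz
    simp_all
  have hint' : ∀ j, Integrable fun z : EuclideanSpace ℝ ι => B z j * f z := fun j =>
    Continuous.integrable_of_hasCompactSupport ((hBc j).mul hf.continuous) hc.mul_left
  have hf_int : Integrable f := hf.continuous.integrable_of_hasCompactSupport hc
  have key : ∀ z : EuclideanSpace ℝ ι, fderiv ℝ f z (B z) =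
      ∑ j, B z j * fderiv ℝ f z (EuclideanSpace.single j 1) := fun z => by
    conv_lhs => rw [← (EuclideanSpace.basisFun ι ℝ).sum_repr (B z)]
    simp
  simp_rw [key]
  rw [integral_finsetSum _ fun j _ => hint j, Finset.sum_mul, ← Finset.sum_neg_distrib]
  refine Finset.sum_congr rfl fun j _ => ?_
  rw [integral_mul_fderiv_eq_neg_fderiv_mul_of_integrable _ (hint j) (hint' j)
    (fun z _ => (hBj j z).differentiableAt) (fun z _ => hf.differentiable one_ne_zero z)]
  · simp_rw [hfB, integral_const_mul]
  · simp_rw [hfB]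
    exact hf_int.const_mul _

theorem integral_fderiv_apply_self {f : EuclideanSpace ℝ ι → ℝ} (hf : ContDiff ℝ 1 f)
    (hc : HasCompactSupport f) :
    ∫ z, fderiv ℝ f z z = -(Fintype.card ι * ∫ z, f z) := by
  simpa using integral_fderiv_apply_clm hf hc (ContinuousLinearMap.id ℝ _)

theorem integral_fderiv_apply_skew {f : EuclideanSpace ℝ ι → ℝ} (hf : ContDiff ℝ 1 f)
    (hc : HasCompactSupport f) {B : EuclideanSpace ℝ ι →L[ℝ] EuclideanSpace ℝ ι}
    (hB : ∀ z, inner ℝ z (B z) = 0) :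
    ∫ z, fderiv ℝ f z (B z) = 0 := by
  rw [integral_fderiv_apply_clm hf hc B, Finset.sum_eq_zero, zero_mul, neg_zero]
  intro j _
  simpa [EuclideanSpace.inner_single_left] using hB (EuclideanSpace.single j 1)

/-- The pairing of a closed one-form with the commutator of two infinitesimal rotations
integrates to zero against every cut-off function which is invariant under these rotations. -/
theorem integral_closed_commutator {h : EuclideanSpace ℝ ι → ℝ}
    {β : EuclideanSpace ℝ ι → EuclideanSpace ℝ ι →L[ℝ] ℝ}
    (hh : ContDiff ℝ 1 h) (hc : HasCompactSupport h)
    (hβ : ∀ z ∈ tsupport h, ContDiffAt ℝ 1 β z)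
    (hclosed : ∀ z ∈ tsupport h, ∀ v w, fderiv ℝ β z v w = fderiv ℝ β z w v)
    {B C : EuclideanSpace ℝ ι →L[ℝ] EuclideanSpace ℝ ι}
    (hB : ∀ z, inner ℝ z (B z) = 0) (hC : ∀ z, inner ℝ z (C z) = 0)
    (hhB : ∀ z, fderiv ℝ h z (B z) = 0) (hhC : ∀ z, fderiv ℝ h z (C z) = 0) :
    ∫ z, h z * β z (C (B z) - B (C z)) = 0 := by
  have zero : ∀ (A : EuclideanSpace ℝ ι →L[ℝ] EuclideanSpace ℝ ι), ∀ z ∉ tsupport h,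
      (fun z => h z * β z (A z)) =ᶠ[𝓝 z] fun _ => 0 := fun A z hz => by
    filter_upwards [notMem_tsupport_iff_eventuallyEq.mp hz] with y hy
    simp [hy]
  have smooth : ∀ A : EuclideanSpace ℝ ι →L[ℝ] EuclideanSpace ℝ ι,
      ContDiff ℝ 1 fun z => h z * β z (A z) := fun A => by
    refine contDiff_iff_contDiffAt.mpr fun z => ?_
    by_cases hz : z ∈ tsupport h
    · exact hh.contDiffAt.mul ((hβ z hz).clm_apply A.contDiff.contDiffAt)
    · exact contDiffAt_const.congr_of_eventuallyEq (zero A z hz)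
  have supp : ∀ A : EuclideanSpace ℝ ι →L[ℝ] EuclideanSpace ℝ ι,
      HasCompactSupport fun z => h z * β z (A z) := fun A => hc.mul_right
  have deriv : ∀ A A' : EuclideanSpace ℝ ι →L[ℝ] EuclideanSpace ℝ ι,
      (∀ z, fderiv ℝ h z (A' z) = 0) → ∀ z,
      fderiv ℝ (fun z => h z * β z (A z)) z (A' z) =
        h z * (fderiv ℝ β z (A' z) (A z) + β z (A (A' z))) := fun A A' hA' z => by
    by_cases hz : z ∈ tsupport h
    · have h1 : HasFDerivAt (fun z => β z (A z)) _ z :=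
        ((hβ z hz).differentiableAt one_ne_zero).hasFDerivAt.clm_apply A.hasFDerivAt
      have h2 : HasFDerivAt (fun z => h z * β z (A z)) _ z :=
        ((hh.differentiable one_ne_zero) z).hasFDerivAt.mul h1
      rw [h2.fderiv]
      simp [hA' z]
      ring
    · rw [(zero A z hz).fderiv_eq, image_eq_zero_of_notMem_tsupport hz]
      simp
  have hBC := integral_fderiv_apply_skew (smooth C) (supp C) hB
  have hCB := integral_fderiv_apply_skew (smooth B) (supp B) hC
  have integrable : ∀ A A' : EuclideanSpace ℝ ι →L[ℝ] EuclideanSpace ℝ ι,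
      Integrable fun z => fderiv ℝ (fun z => h z * β z (A z)) z (A' z) := fun A A' => by
    refine Continuous.integrable_of_hasCompactSupport
      (((smooth A).continuous_fderiv one_ne_zero).clm_apply A'.continuous) ?_
    refine ((supp A).fderiv ℝ).mono fun z hz => ?_
    contrapose! hz
    simp_all
  rw [← sub_eq_zero.mpr (hBC.trans hCB.symm), ← integral_sub (integrable C B) (integrable B C)]
  congr 1 with z
  rw [deriv C B hhB, deriv B C hhC, map_sub]
  by_cases hz : z ∈ tsupport h
  · rw [hclosed z hz (B z) (C z)]; ring
  · rw [image_eq_zero_of_notMem_tsupport hz]; ring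

/-- The infinitesimal rotation in the `(a, b)`-coordinate plane. -/
def planeRotation (a b : ι) : EuclideanSpace ℝ ι →L[ℝ] EuclideanSpace ℝ ι :=
  (EuclideanSpace.proj (𝕜 := ℝ) a).smulRight (EuclideanSpace.single b 1) -
    (EuclideanSpace.proj (𝕜 := ℝ) b).smulRight (EuclideanSpace.single a 1)

theorem planeRotation_apply (a b : ι) (v : EuclideanSpace ℝ ι) :
    planeRotation a b v =
      v a • EuclideanSpace.single b 1 - v b • EuclideanSpace.single a 1 := by
  simp [planeRotation]

theorem inner_planeRotation (a b : ι) (v w : EuclideanSpace ℝ ι) :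
    inner ℝ (planeRotation a b v) w = v a * w b - v b * w a := by
  simp [planeRotation_apply, inner_sub_left, inner_smul_left, EuclideanSpace.inner_single_left]

theorem inner_self_planeRotation (a b : ι) (v : EuclideanSpace ℝ ι) :
    inner ℝ v (planeRotation a b v) = 0 := by
  rw [real_inner_comm, inner_planeRotation]; ring

theorem planeRotation_commutator {a b c : ι} (hab : a ≠ b) (hac : a ≠ c) (hbc : b ≠ c)
    (v : EuclideanSpace ℝ ι) :
    planeRotation c b (planeRotation a c v) - planeRotation a c (planeRotation c b v) =
      planeRotation a b v := by
  ext k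
  simp only [planeRotation_apply, PiLp.sub_apply, PiLp.smul_apply, PiLp.single_apply,
    smul_eq_mul, if_neg hab, if_neg hab.symm, if_neg hac, if_neg hac.symm, if_neg hbc,
    if_neg hbc.symm, if_true]
  ring

end Integration

section SymplecticLinearAlgebra

variable {n : ℕ}

/-- The index of the coordinate `x_i`. -/
def xIdx (i : Fin n) : Fin (2 * n) := ⟨2 * i.1, by have := i.isLt; omega⟩

/-- The index of the coordinate `y_i`. -/
def yIdx (i : Fin n) : Fin (2 * n) := ⟨2 * i.1 + 1, by have := i.isLt; omega⟩

/-- The standard complex structure of `ℝ^{2n}`. -/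
def stdJ (n : ℕ) : R2n n →L[ℝ] R2n n := ∑ i, planeRotation (xIdx i) (yIdx i)

theorem stdJ_apply (v : R2n n) : stdJ n v = ∑ i, planeRotation (xIdx i) (yIdx i) v := by
  simp [stdJ]

theorem sympForm_eq_inner (v w : R2n n) : sympForm n v w = inner ℝ (stdJ n v) w := by
  simp_rw [stdJ_apply, sum_inner, inner_planeRotation]
  rfl

theorem xIdx_ne_yIdx (i j : Fin n) : xIdx i ≠ yIdx j := by
  simp [xIdx, yIdx]; omega

theorem xIdx_injective : Function.Injective (xIdx (n := n)) := fun i j h => by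
  simpa [xIdx, Fin.ext_iff] using h

theorem yIdx_injective : Function.Injective (yIdx (n := n)) := fun i j h => by
  simpa [yIdx, Fin.ext_iff] using h

theorem exists_eq_xIdx_or_yIdx (k : Fin (2 * n)) : ∃ i, k = xIdx i ∨ k = yIdx i := by
  refine ⟨⟨k.1 / 2, by have := k.isLt; omega⟩, ?_⟩
  simp only [xIdx, yIdx, Fin.ext_iff]
  omega

theorem stdJ_xIdx (v : R2n n) (j : Fin n) : stdJ n v (xIdx j) = -v (yIdx j) := by
  simp [stdJ_apply, planeRotation_apply, Pi.single_apply, xIdx_ne_yIdx, xIdx_injective.eq_iff]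

theorem stdJ_yIdx (v : R2n n) (j : Fin n) : stdJ n v (yIdx j) = v (xIdx j) := by
  simp [stdJ_apply, planeRotation_apply, Pi.single_apply, (xIdx_ne_yIdx _ _).symm, yIdx_injective.eq_iff]

theorem stdJ_stdJ (v : R2n n) : stdJ n (stdJ n v) = -v := by
  ext k
  obtain ⟨i, rfl | rfl⟩ := exists_eq_xIdx_or_yIdx k <;> simp [stdJ_xIdx, stdJ_yIdx]

theorem inner_stdJ_left (v w : R2n n) : inner ℝ (stdJ n v) w = -inner ℝ v (stdJ n w) := by
  rw [real_inner_comm (stdJ n w) v, ← sympForm_eq_inner, ← sympForm_eq_inner]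
  simp only [sympForm, ← Finset.sum_neg_distrib]
  exact Finset.sum_congr rfl fun i _ => by ring

theorem inner_self_stdJ (v : R2n n) : inner ℝ v (stdJ n v) = 0 := by
  have := inner_stdJ_left v v
  rw [real_inner_comm] at this
  linarith

theorem inner_stdJ_stdJ (v w : R2n n) : inner ℝ (stdJ n v) (stdJ n w) = inner ℝ v w := by
  rw [inner_stdJ_left, stdJ_stdJ, inner_neg_right, neg_neg]

theorem abs_det_eq_one_of_symplectic {L : R2n n →L[ℝ] R2n n}
    (hL : ∀ v w, sympForm n (L v) (L w) = sympForm n v w) : |L.det| = 1 := by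
  have hcomp : LinearMap.adjoint (L : R2n n →ₗ[ℝ] R2n n) ∘ₗ (stdJ n : R2n n →ₗ[ℝ] R2n n) ∘ₗ
      (L : R2n n →ₗ[ℝ] R2n n) = stdJ n := by
    ext1 v
    refine ext_inner_right ℝ fun w => ?_
    rw [LinearMap.comp_apply, LinearMap.adjoint_inner_left]
    simpa [sympForm_eq_inner] using hL v w
  have hadj : LinearMap.det (LinearMap.adjoint (L : R2n n →ₗ[ℝ] R2n n)) = L.det := by
    let b := EuclideanSpace.basisFun (Fin (2 * n)) ℝ
    rw [← LinearMap.det_toMatrix b.toBasis, LinearMap.toMatrix_adjoint, Matrix.det_conjTranspose,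
      LinearMap.det_toMatrix]
    rfl
  have hJ : LinearMap.det (stdJ n : R2n n →ₗ[ℝ] R2n n) ≠ 0 := by
    have hJJ : (stdJ n : R2n n →ₗ[ℝ] R2n n) ∘ₗ (-(stdJ n : R2n n →ₗ[ℝ] R2n n)) =
        LinearMap.id := by
      ext1 v; simp [stdJ_stdJ]
    intro h0
    have := congrArg LinearMap.det hJJ
    rw [LinearMap.det_comp, h0, zero_mul, LinearMap.det_id] at this
    exact zero_ne_one this
  have hdet := congrArg LinearMap.det hcomp
  rw [LinearMap.det_comp, LinearMap.det_comp, hadj] at hdet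
  have hsq : L.det ^ 2 = 1 := by
    apply mul_right_cancel₀ hJ
    rw [one_mul]
    nth_rewrite 2 [← hdet]
    change _ = L.det * (_ * L.det)
    ring
  exact (pow_eq_one_iff_of_nonneg (abs_nonneg _) two_ne_zero).mp (by rw [sq_abs, hsq])

end SymplecticLinearAlgebra

section SymplecticIntegral

variable {n : ℕ}

/-- For a symplectic map `φ` defined near the support of a radial function `h`, the integral of
`h(z) (φ^*λ)(Jz)` is the same as for the identity; here `λ = ω(z, ·)`. -/
theorem integral_sympForm_stdJ (hn : 2 ≤ n) {φ : R2n n → R2n n} {h : R2n n → ℝ}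
    (hh : ContDiff ℝ 1 h) (hc : HasCompactSupport h)
    (hφ : ∀ z ∈ tsupport h, ContDiffAt ℝ 2 φ z)
    (hsymp : ∀ z ∈ tsupport h, ∀ᶠ y in 𝓝 z, ∀ v w : R2n n,
      sympForm n (fderiv ℝ φ y v) (fderiv ℝ φ y w) = sympForm n v w)
    (hrad : ∀ B : R2n n →L[ℝ] R2n n, (∀ z, inner ℝ z (B z) = 0) → ∀ z, fderiv ℝ h z (B z) = 0) :
    ∫ z, h z * sympForm n (φ z) (fderiv ℝ φ z (stdJ n z)) = ∫ z, h z * ‖z‖ ^ 2 := by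
  let ωL : R2n n →L[ℝ] R2n n →L[ℝ] ℝ := (innerSL ℝ).comp (stdJ n)
  have hωL : ∀ v w, ωL v w = sympForm n v w := fun v w => by
    simp [ωL, sympForm_eq_inner]
  let β : R2n n → R2n n →L[ℝ] ℝ := fun z => (ωL (φ z)).comp (fderiv ℝ φ z) - ωL z
  have hdφ : ∀ z ∈ tsupport h, ContDiffAt ℝ 1 (fderiv ℝ φ) z := fun z hz =>
    (hφ z hz).fderiv_right (by norm_num)
  have hβ : ∀ z ∈ tsupport h, ContDiffAt ℝ 1 β z := fun z hz =>
    ((ωL.contDiff.contDiffAt.comp z ((hφ z hz).of_le (by norm_num))).clm_comp (hdφ z hz)).sub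
      ωL.contDiff.contDiffAt
  have hclosed : ∀ z ∈ tsupport h, ∀ v w, fderiv ℝ β z v w = fderiv ℝ β z w v := by
    intro z hz v w
    have h1 : HasFDerivAt φ (fderiv ℝ φ z) z :=
      ((hφ z hz).differentiableAt (by norm_num)).hasFDerivAt
    have h2 : HasFDerivAt (fderiv ℝ φ) (fderiv ℝ (fderiv ℝ φ) z) z :=
      ((hdφ z hz).differentiableAt one_ne_zero).hasFDerivAt
    have h3 : HasFDerivAt β _ z := ((ωL.hasFDerivAt.comp z h1).clm_comp h2).sub ωL.hasFDerivAt
    have hs : fderiv ℝ (fderiv ℝ φ) z v w = fderiv ℝ (fderiv ℝ φ) z w v :=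
      ((hφ z hz).isSymmSndFDerivAt (by simp)) v w
    rw [h3.fderiv]
    simp [hωL, (hsymp z hz).self_of_nhds, hs]
  have hrot : ∀ i : Fin n, ∫ z, h z * β z (planeRotation (xIdx i) (yIdx i) z) = 0 := by
    intro i
    obtain ⟨c, hac, hbc⟩ : ∃ c, xIdx i ≠ c ∧ yIdx i ≠ c := by
      have : Nontrivial (Fin n) := Fin.nontrivial_iff_two_le.mpr hn
      obtain ⟨j, hj⟩ := exists_ne i
      exact ⟨xIdx j, xIdx_injective.ne hj.symm, (xIdx_ne_yIdx _ _).symm⟩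
    have := integral_closed_commutator (B := planeRotation (xIdx i) c)
      (C := planeRotation c (yIdx i)) hh hc hβ hclosed (inner_self_planeRotation _ _)
      (inner_self_planeRotation _ _) (hrad _ (inner_self_planeRotation _ _))
      (hrad _ (inner_self_planeRotation _ _))
    simpa only [planeRotation_commutator (xIdx_ne_yIdx i i) hac hbc] using this
  have hcont : ∀ A : R2n n →L[ℝ] R2n n, Integrable fun z => h z * β z (A z) := fun A => by
    refine Continuous.integrable_of_hasCompactSupport ?_ hc.mul_right
    refine continuous_iff_continuousAt.mpr fun z => ?_
    by_cases hz : z ∈ tsupport h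
    · exact hh.continuous.continuousAt.mul
        ((hβ z hz).continuousAt.clm_apply A.continuous.continuousAt)
    · refine (continuousAt_const (y := (0 : ℝ))).congr ?_
      filter_upwards [notMem_tsupport_iff_eventuallyEq.mp hz] with y hy
      simp [hy]
  have hJ : ∫ z, h z * β z (stdJ n z) = 0 := by
    simp_rw [stdJ_apply, map_sum, Finset.mul_sum]
    rw [integral_finsetSum _ fun i _ => hcont _]
    exact Finset.sum_eq_zero fun i _ => hrot i
  have hnorm : Integrable fun z : R2n n => h z * ‖z‖ ^ 2 :=
    (hh.continuous.mul (by fun_prop)).integrable_of_hasCompactSupport hc.mul_right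
  have hsplit : ∀ z, h z * sympForm n (φ z) (fderiv ℝ φ z (stdJ n z)) =
      h z * β z (stdJ n z) + h z * ‖z‖ ^ 2 := fun z => by
    have : ωL z (stdJ n z) = ‖z‖ ^ 2 := by
      rw [hωL, sympForm_eq_inner, inner_stdJ_stdJ, real_inner_self_eq_norm_sq]
    simp only [β, sub_apply, ContinuousLinearMap.comp_apply, hωL]
    rw [← hωL z, this]
    ring
  simp_rw [hsplit]
  rw [integral_add (hcont _) hnorm, hJ, zero_add]

end SymplecticIntegral

section RadialCutoff

variable {E : Type*} [NormedAddCommGroup E] [InnerProductSpace ℝ E]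

theorem hasFDerivAt_comp_norm_sq {τ : ℝ → ℝ} {τ' : ℝ} {z : E} (hτ : HasDerivAt τ τ' (‖z‖ ^ 2)) :
    HasFDerivAt (fun z : E => τ (‖z‖ ^ 2)) ((2 * τ') • innerSL ℝ z) z := by
  have := hτ.comp_hasFDerivAt z (hasStrictFDerivAt_norm_sq z).hasFDerivAt
  convert! this using 1
  rw [smul_comm, ← Nat.cast_smul_eq_nsmul ℝ, smul_smul]
  simp

theorem exists_smooth_step {α γ : ℝ} (h : α < γ) : ∃ τ : ℝ → ℝ, ContDiff ℝ ∞ τ ∧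
    (∀ s ≤ α, τ s = 1) ∧ ∀ s, γ ≤ s → τ s = 0 := by
  refine ⟨fun s => smoothTransition ((γ - s) / (γ - α)), ?_, fun s hs => ?_, fun s hs => ?_⟩
  · exact smoothTransition.contDiff.comp (by fun_prop)
  · exact smoothTransition.one_of_one_le ((one_le_div (by linarith)).mpr (by linarith))
  · exact smoothTransition.zero_of_nonpos
      (div_nonpos_of_nonpos_of_nonneg (by linarith) (by linarith))

theorem deriv_smooth_step_eq_zero {τ : ℝ → ℝ} {α γ : ℝ} (h1 : ∀ s ≤ α, τ s = 1)
    (h0 : ∀ s, γ ≤ s → τ s = 0) {s : ℝ} (hs : s ∉ Icc α γ) : deriv τ s = 0 := by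
  rw [mem_Icc, not_and_or, not_le, not_le] at hs
  rcases hs with hs | hs
  · have : τ =ᶠ[𝓝 s] fun _ => 1 := by
      filter_upwards [Iio_mem_nhds hs] with t ht using h1 t (le_of_lt ht)
    rw [this.deriv_eq, deriv_const]
  · have : τ =ᶠ[𝓝 s] fun _ => 0 := by
      filter_upwards [Ioi_mem_nhds hs] with t ht using h0 t (le_of_lt ht)
    rw [this.deriv_eq, deriv_const]

theorem isCompact_norm_sq_mem_Icc [FiniteDimensional ℝ E] (α γ : ℝ) :
    IsCompact {z : E | ‖z‖ ^ 2 ∈ Icc α γ} := by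
  refine isCompact_of_isClosed_isBounded
    (isClosed_Icc.preimage (by fun_prop)) ?_
  refine (isBounded_closedBall (x := (0 : E)) (r := √γ)).subset fun z hz => ?_
  rw [mem_closedBall_zero_iff]
  exact le_sqrt_of_sq_le hz.2

theorem isPreconnected_norm_sq_mem (hE : 1 < Module.rank ℝ E) {I : Set ℝ} (hI : IsPreconnected I)
    (hpos : I ⊆ Ioi 0) : IsPreconnected {z : E | ‖z‖ ^ 2 ∈ I} := by
  have h := (hI.prod (isPreconnected_sphere hE (0 : E) 1)).image
    (fun p : ℝ × E => √p.1 • p.2) (by fun_prop)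
  convert! h using 1
  ext z
  simp only [mem_ofPred_eq, mem_image, mem_prod, mem_sphere_zero_iff_norm, Prod.exists]
  constructor
  · intro hz
    have hz0 : ‖z‖ ≠ 0 := fun h0 => by simpa [h0] using hpos hz
    refine ⟨‖z‖ ^ 2, ‖z‖⁻¹ • z, ⟨hz, ?_⟩, ?_⟩
    · rw [norm_smul, norm_inv, norm_norm, inv_mul_cancel₀ hz0]
    · rw [sqrt_sq (norm_nonneg z), smul_smul, mul_inv_cancel₀ hz0, one_smul]
  · rintro ⟨s, u, ⟨hs, hu⟩, rfl⟩
    rw [norm_smul, hu, mul_one, norm_of_nonneg (sqrt_nonneg s), sq_sqrt (hpos hs).le]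
    exact hs

/-- An open neighbourhood of a sphere contains a shell around it. -/
theorem exists_shell_subset [FiniteDimensional ℝ E] {r : ℝ} (hr : 0 < r) {N : Set E}
    (hN : IsOpen N) (hS : sphere 0 r ⊆ N) :
    ∃ ε, 0 < ε ∧ ε ≤ r ^ 2 ∧ {z : E | ‖z‖ ^ 2 ∈ Ioo (r ^ 2 - ε) (r ^ 2 + ε)} ⊆ N := by
  obtain ⟨δ, hδ, hδN⟩ := (isCompact_sphere (0 : E) r).exists_thickening_subset_open hN hS
  refine ⟨min (δ * r) (r ^ 2), by positivity, min_le_right _ _, fun z hz => hδN ?_⟩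
  have hz' : |‖z‖ ^ 2 - r ^ 2| < min (δ * r) (r ^ 2) :=
    abs_lt.mpr ⟨by linarith [hz.1], by linarith [hz.2]⟩
  have hz0 : 0 < ‖z‖ := by
    rcases (norm_nonneg z).lt_or_eq with h | h
    · exact h
    · have := hz'.trans_le (min_le_right _ _)
      rw [← h] at this
      norm_num [abs_of_pos (pow_pos hr 2)] at this
  have hfac : |‖z‖ ^ 2 - r ^ 2| = |‖z‖ - r| * (‖z‖ + r) := by
    rw [sq_sub_sq, abs_mul, abs_of_pos (add_pos hz0 hr), mul_comm]
  have hlt : |‖z‖ - r| < δ := by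
    have h1 := hz'.trans_le (min_le_left _ _)
    rw [hfac] at h1
    nlinarith [abs_nonneg (‖z‖ - r)]
  refine mem_thickening_iff.mpr ⟨(r / ‖z‖) • z, ?_, ?_⟩
  · rw [mem_sphere_zero_iff_norm, norm_smul, norm_div, norm_norm, norm_of_nonneg hr.le]
    field_simp
  · rw [dist_eq_norm]
    have : z - (r / ‖z‖) • z = ((‖z‖ - r) / ‖z‖) • z := by
      rw [sub_div, div_self hz0.ne', sub_smul, one_smul]
    rw [this, norm_smul, norm_div, norm_norm, div_mul_cancel₀ _ hz0.ne']
    exact hlt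

end RadialCutoff

section Transport

variable {n : ℕ}

/-- If `g` is compactly supported, locally constant away from the image of a symplectic
embedding `φ` of `U`, and pulls back to the radial function `b + c τ(|z|²)` on `U`, where `τ`
is a smooth step whose transition region lies in `U`, then `∫ g = c ∫ τ(|z|²)`. -/
theorem integral_eq_of_comp_radial (hn : 2 ≤ n) {U : Set (R2n n)} {φ : R2n n → R2n n}
    (hφ : IsSympEmbOn n U univ φ) {τ : ℝ → ℝ} {α γ : ℝ} (hτ : ContDiff ℝ ∞ τ)
    (hτ1 : ∀ s ≤ α, τ s = 1) (hτ0 : ∀ s, γ ≤ s → τ s = 0)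
    (hKU : {z : R2n n | ‖z‖ ^ 2 ∈ Icc α γ} ⊆ U)
    {g : R2n n → ℝ} (hg : ContDiff ℝ 1 g) (hgc : HasCompactSupport g) {b c : ℝ}
    (hgφ : ∀ z ∈ U, g (φ z) = b + c * τ (‖z‖ ^ 2))
    (hg0 : ∀ x ∉ φ '' U, fderiv ℝ g x = 0) :
    ∫ x, g x = c * ∫ z : R2n n, τ (‖z‖ ^ 2) := by
  obtain ⟨hU, hφs, hinj, -, hsymp⟩ := hφ
  have hφat : ∀ z ∈ U, ContDiffAt ℝ ∞ φ z := fun z hz => hφs.contDiffAt (hU.mem_nhds hz)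
  have hφd : ∀ z ∈ U, HasFDerivAt φ (fderiv ℝ φ z) z := fun z hz =>
    ((hφat z hz).differentiableAt (by simp)).hasFDerivAt
  let h : R2n n → ℝ := fun z => 2 * deriv τ (‖z‖ ^ 2)
  have hτ' : ContDiff ℝ ∞ (deriv τ) := ((contDiff_infty_iff_deriv).mp hτ).2
  have hσ' : ∀ z : R2n n,
      HasFDerivAt (fun z : R2n n => τ (‖z‖ ^ 2)) (h z • innerSL ℝ z) z := fun z =>
    hasFDerivAt_comp_norm_sq ((hτ.differentiable (by simp)) _).hasDerivAt
  have hσ : ContDiff ℝ 1 fun z : R2n n => τ (‖z‖ ^ 2) :=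
    (hτ.of_le (by simp)).comp (contDiff_norm_sq ℝ)
  have hσc : HasCompactSupport fun z : R2n n => τ (‖z‖ ^ 2) := by
    refine HasCompactSupport.intro (isCompact_norm_sq_mem_Icc 0 γ) fun z hz => hτ0 _ ?_
    by_contra! hlt
    exact hz ⟨by positivity, hlt.le⟩
  have hh : ContDiff ℝ 1 h :=
    contDiff_const.mul ((hτ'.of_le (by simp)).comp (contDiff_norm_sq ℝ))
  have hhK : tsupport h ⊆ {z | ‖z‖ ^ 2 ∈ Icc α γ} := by
    refine closure_minimal (fun z hz => ?_) (isCompact_norm_sq_mem_Icc α γ).isClosed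
    by_contra hzK
    exact hz (by simp [h, deriv_smooth_step_eq_zero hτ1 hτ0 hzK])
  have hhU : ∀ z ∉ U, h z = 0 := fun z hz =>
    image_eq_zero_of_notMem_tsupport fun hz' => hz (hKU (hhK hz'))
  have hhc : HasCompactSupport h :=
    (isCompact_norm_sq_mem_Icc α γ).of_isClosed_subset (isClosed_tsupport h) hhK
  have hrad : ∀ B : R2n n →L[ℝ] R2n n, (∀ z, inner ℝ z (B z) = 0) →
      ∀ z, fderiv ℝ h z (B z) = 0 := fun B hB z => by
    have h1 : HasFDerivAt (fun z : R2n n => deriv τ (‖z‖ ^ 2)) _ z :=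
      hasFDerivAt_comp_norm_sq ((hτ'.differentiable (by simp)) _).hasDerivAt
    rw [(h1.const_mul 2).fderiv]
    simp [hB z]
  have hmain := integral_sympForm_stdJ hn hh hhc
    (fun z hz => by exact_mod_cast contDiffAt_infty.mp (hφat z (hKU (hhK hz))) 2)
    (fun z hz => by
      filter_upwards [hU.mem_nhds (hKU (hhK hz))] with y hy using hsymp y hy) hrad
  have hpoint : ∀ z ∈ U, |(fderiv ℝ φ z).det| • fderiv ℝ g (φ z) (φ z) =
      c * (h z * sympForm n (φ z) (fderiv ℝ φ z (stdJ n z))) := fun z hz => by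
    have hdet := abs_det_eq_one_of_symplectic (hsymp z hz)
    have hdet0 : (fderiv ℝ φ z).det ≠ 0 := fun h0 => by simp [h0] at hdet
    obtain ⟨u, hu⟩ : ∃ u, fderiv ℝ φ z u = φ z :=
      ⟨((fderiv ℝ φ z).toContinuousLinearEquivOfDetNeZero hdet0).symm (φ z),
        ((fderiv ℝ φ z).toContinuousLinearEquivOfDetNeZero hdet0).apply_symm_apply (φ z)⟩
    have hchain : (fderiv ℝ g (φ z)).comp (fderiv ℝ φ z) = c • h z • innerSL ℝ z := by
      have h1 := ((hg.differentiable one_ne_zero) (φ z)).hasFDerivAt.comp z (hφd z hz)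
      refine h1.unique ((((hσ' z).const_mul c).const_add b).congr_of_eventuallyEq ?_)
      filter_upwards [hU.mem_nhds hz] with y hy using hgφ y hy
    have hval := congrArg (fun L => L u) hchain
    simp only [ContinuousLinearMap.comp_apply, hu] at hval
    rw [hdet, one_smul, hval]
    rw [← hu, hsymp z hz, sympForm_eq_inner, inner_stdJ_stdJ]
    simp [real_inner_comm]
  have hleft : ∫ x, fderiv ℝ g x x =
      c * ∫ z, h z * sympForm n (φ z) (fderiv ℝ φ z (stdJ n z)) := by
    rw [← setIntegral_eq_integral_of_forall_compl_eq_zero (s := φ '' U)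
        (fun x hx => by simp [hg0 x hx]),
      integral_image_eq_integral_abs_det_fderiv_smul volume hU.measurableSet
        (fun z hz => (hφd z hz).hasFDerivWithinAt) hinj,
      setIntegral_congr_fun hU.measurableSet hpoint, integral_const_mul,
      setIntegral_eq_integral_of_forall_compl_eq_zero fun z hz => by simp [hhU z hz]]
  have hright : ∫ z, h z * ‖z‖ ^ 2 = ∫ z : R2n n, fderiv ℝ (fun z => τ (‖z‖ ^ 2)) z z := by
    congr 1 with z
    rw [(hσ' z).fderiv]
    simp
  rw [hmain, hright, integral_fderiv_apply_self hg hgc, integral_fderiv_apply_self hσ hσc,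
    Fintype.card_fin] at hleft
  have hn0 : ((2 * n : ℕ) : ℝ) ≠ 0 := by positivity
  apply mul_left_cancel₀ hn0
  linarith

end Transport

section ComponentIndicator

theorem isOpen_diff_connectedComponentIn {X : Type*} [TopologicalSpace X]
    [LocallyConnectedSpace X] {O : Set X} (hO : IsOpen O) (x : X) :
    IsOpen (O \ connectedComponentIn O x) := by
  refine isOpen_iff_mem_nhds.mpr fun y hy => ?_
  refine mem_of_superset (hO.connectedComponentIn.mem_nhds (mem_connectedComponentIn hy.1))
    fun w hw => ⟨connectedComponentIn_subset O y hw, fun hwx => hy.2 ?_⟩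
  rw [connectedComponentIn_eq hwx, ← connectedComponentIn_eq hw]
  exact mem_connectedComponentIn hy.1

theorem indicator_eventually_const {X : Type*} [TopologicalSpace X]
    [LocallyConnectedSpace X] {O : Set X} (hO : IsOpen O) (x : X) {y : X} (hy : y ∈ O) :
    ∀ᶠ w in 𝓝 y, (connectedComponentIn O x).indicator (1 : X → ℝ) w =
      (connectedComponentIn O x).indicator 1 y := by
  by_cases hyx : y ∈ connectedComponentIn O x
  · filter_upwards [hO.connectedComponentIn.mem_nhds hyx] with w hw
    simp [hw, hyx]
  · filter_upwards [(isOpen_diff_connectedComponentIn hO x).mem_nhds ⟨hy, hyx⟩] with w hw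
    simp [hw.2, hyx]

/-- The indicator of a component is constant on connected subsets. -/
theorem exists_indicator_eq_of_isPreconnected {X : Type*} [TopologicalSpace X] {O A : Set X}
    (hA : IsPreconnected A) (hAO : A ⊆ O) (x : X) :
    ∃ a : ℝ, (a = 0 ∨ a = 1) ∧
      ∀ y ∈ A, (connectedComponentIn O x).indicator (1 : X → ℝ) y = a := by
  by_cases h : ∃ y ∈ A, y ∈ connectedComponentIn O x
  · obtain ⟨y, hyA, hyx⟩ := h
    refine ⟨1, Or.inr rfl, fun w hw => ?_⟩
    have : w ∈ connectedComponentIn O x := by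
      rw [connectedComponentIn_eq hyx]
      exact hA.subset_connectedComponentIn hyA hAO hw
    simp [this]
  · push Not at h
    exact ⟨0, Or.inl rfl, fun w hw => by simp [h w hw]⟩

end ComponentIndicator

/-- A smooth injective map with invertible derivative is an open partial homeomorphism with
smooth inverse. -/
theorem exists_openPartialHomeomorph_of_injOn {E : Type*} [NormedAddCommGroup E]
    [NormedSpace ℝ E] [FiniteDimensional ℝ E] {U : Set E} {φ : E → E} (hU : IsOpen U)
    (hφ : ContDiffOn ℝ ∞ φ U) (hinj : InjOn φ U) (hdet : ∀ z ∈ U, (fderiv ℝ φ z).det ≠ 0) :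
    ∃ e : OpenPartialHomeomorph E E, e.source = U ∧ (∀ z, e z = φ z) ∧
      ∀ x ∈ e.target, ContDiffAt ℝ ∞ e.symm x := by
  have hφat : ∀ z ∈ U, ContDiffAt ℝ ∞ φ z := fun z hz => hφ.contDiffAt (hU.mem_nhds hz)
  let L : ∀ z ∈ U, E ≃L[ℝ] E := fun z hz =>
    (fderiv ℝ φ z).toContinuousLinearEquivOfDetNeZero (hdet z hz)
  have hopen : IsOpenMap (U.domRestrict φ) := by
    rw [isOpenMap_iff_nhds_le]
    rintro ⟨z, hz⟩
    have hstrict : HasStrictFDerivAt φ (L z hz : E →L[ℝ] E) z :=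
      (hφat z hz).hasStrictFDerivAt (by simp)
    have hmap := hstrict.map_nhds_eq_of_equiv
    rw [← map_nhds_subtype_coe_eq_nhds hz (hU.mem_nhds hz), Filter.map_map] at hmap
    exact hmap.ge
  let e := OpenPartialHomeomorph.ofContinuousOpenRestrict hinj.toPartialEquiv
    hφ.continuousOn hopen hU
  refine ⟨e, rfl, fun _ => rfl, fun x hx => ?_⟩
  have hxU : e.symm x ∈ U := e.map_target hx
  exact e.contDiffAt_symm (f₀' := L _ hxU) hx
    ((hφat _ hxU).differentiableAt (by simp)).hasFDerivAt (hφat _ hxU)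

section Helicity

variable {n : ℕ}

theorem one_lt_rank_R2n (hn : 2 ≤ n) : 1 < Module.rank ℝ (R2n n) := by
  rw [← Module.finrank_eq_rank, finrank_euclideanSpace_fin]
  exact_mod_cast (by omega : 1 < 2 * n)

theorem volume_ball_R2n (hn : 2 ≤ n) {r : ℝ} (hr : 0 < r) :
    volume (ball (0 : R2n n) r) = ENNReal.ofReal (π ^ n * r ^ (2 * n) / n.factorial) := by
  have : Nontrivial (R2n n) := Module.nontrivial_of_finrank_pos (R := ℝ) (by
    rw [finrank_euclideanSpace_fin]; omega)
  rw [InnerProductSpace.volume_ball_of_dim_even (k := n) finrank_euclideanSpace_fin,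
    finrank_euclideanSpace_fin, ← ENNReal.ofReal_pow hr.le, ← ENNReal.ofReal_mul (by positivity)]
  congr 1
  ring

/-- The volume of a bounded component is the jump of its indicator across the image of the
sphere, times the volume of the ball. -/
theorem volume_component_eq_jump_mul (hn : 2 ≤ n) {r ε : ℝ} (hr : 0 < r) (hε : 0 < ε)
    {U : Set (R2n n)} (hUdef : U = {z | ‖z‖ ^ 2 ∈ Ioo (r ^ 2 - ε) (r ^ 2 + ε)})
    {φ : R2n n → R2n n} (hφ : IsSympEmbOn n U univ φ) {O : Set (R2n n)}
    (hO : O = (φ '' sphere (0 : R2n n) r)ᶜ) {x : R2n n} {D : Set (R2n n)}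
    (hD : D = connectedComponentIn O x) (hbd : IsBounded D) {a b : ℝ}
    (ha : ∀ z ∈ U, ‖z‖ < r → D.indicator (1 : R2n n → ℝ) (φ z) = a)
    (hb : ∀ z ∈ U, r < ‖z‖ → D.indicator (1 : R2n n → ℝ) (φ z) = b) :
    volume.real D = (a - b) * volume.real (ball (0 : R2n n) r) := by
  classical
  obtain ⟨hU, hφs, hinj, -, hsymp⟩ := id hφ
  have hdet : ∀ z ∈ U, |(fderiv ℝ φ z).det| = 1 := fun z hz =>
    abs_det_eq_one_of_symplectic (hsymp z hz)
  obtain ⟨e, heU, heφ, hesymm⟩ := exists_openPartialHomeomorph_of_injOn hU hφs hinj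
    fun z hz h0 => by simpa [h0] using hdet z hz
  have hetarget : e.target = φ '' U := by
    rw [← e.image_source_eq_target, heU]
    exact image_congr fun z _ => heφ z
  have hleft : ∀ z ∈ U, e.symm (φ z) = z := fun z hz => by
    rw [← heφ]; exact e.left_inv (heU ▸ hz)
  obtain ⟨τ, hτ, hτ1, hτ0⟩ := exists_smooth_step
    (show r ^ 2 - ε / 2 < r ^ 2 + ε / 2 by linarith)
  set K : Set (R2n n) := {z | ‖z‖ ^ 2 ∈ Icc (r ^ 2 - ε / 2) (r ^ 2 + ε / 2)} with hK
  have hKU : K ⊆ U := by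
    rw [hUdef]
    exact fun z hz => ⟨by linarith [hz.1], by linarith [hz.2]⟩
  have hφK : IsCompact (φ '' K) :=
    (isCompact_norm_sq_mem_Icc _ _).image_of_continuousOn (hφs.continuousOn.mono hKU)
  have hSK : (φ '' K)ᶜ ⊆ O := by
    rw [hO]
    refine compl_subset_compl.mpr (image_mono fun z hz => ?_)
    rw [mem_sphere_zero_iff_norm] at hz
    simp only [hK, mem_ofPred_eq, hz, mem_Icc]
    constructor <;> linarith
  have hOopen : IsOpen O := by
    rw [hO, isOpen_compl_iff]
    refine ((isCompact_sphere _ _).image_of_continuousOn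
      (hφs.continuousOn.mono fun z hz => hKU ?_)).isClosed
    rw [mem_sphere_zero_iff_norm] at hz
    simp only [hK, mem_ofPred_eq, hz, mem_Icc]
    constructor <;> linarith
  have hDopen : IsOpen D := hD ▸ hOopen.connectedComponentIn
  have hDind : ∀ z ∈ U \ K, D.indicator (1 : R2n n → ℝ) (φ z) = b + (a - b) * τ (‖z‖ ^ 2) := by
    rintro z ⟨hzU, hzK⟩
    simp only [hK, mem_ofPred_eq, mem_Icc, not_and_or, not_le] at hzK
    rcases hzK with hz | hz
    · rw [ha z hzU (lt_of_pow_lt_pow_left₀ 2 hr.le (by linarith)), hτ1 _ hz.le]; ring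
    · rw [hb z hzU (lt_of_pow_lt_pow_left₀ 2 (norm_nonneg z) (by linarith)), hτ0 _ hz.le]; ring
  let g : R2n n → ℝ := fun y =>
    if y ∈ φ '' U then b + (a - b) * τ (‖e.symm y‖ ^ 2) else D.indicator 1 y
  have hgφ : ∀ z ∈ U, g (φ z) = b + (a - b) * τ (‖z‖ ^ 2) := fun z hz => by
    simp only [g, if_pos (mem_image_of_mem φ hz), hleft z hz]
  have hgD : ∀ y ∉ φ '' K, g y = D.indicator 1 y := fun y hy => by
    by_cases hyU : y ∈ φ '' U
    · obtain ⟨z, hz, rfl⟩ := hyU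
      rw [hgφ z hz, hDind z ⟨hz, fun hzK => hy (mem_image_of_mem φ hzK)⟩]
    · simp only [g, if_neg hyU]
  have hgconst : ∀ y ∉ φ '' K, g =ᶠ[𝓝 y] fun _ => D.indicator 1 y := fun y hy => by
    have h1 := indicator_eventually_const hOopen x (hSK hy)
    rw [← hD] at h1
    filter_upwards [h1, hφK.isClosed.isOpen_compl.mem_nhds hy] with w hw hwK
    rw [hgD w hwK, hw]
  have hg : ContDiff ℝ 1 g := by
    refine contDiff_iff_contDiffAt.mpr fun y => ?_
    by_cases hyU : y ∈ φ '' U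
    · have h1 : ContDiffAt ℝ 1 (fun y => b + (a - b) * τ (‖e.symm y‖ ^ 2)) y :=
        contDiffAt_const.add (contDiffAt_const.mul (((hτ.of_le (by simp)).contDiffAt).comp y
          (((hesymm y (hetarget ▸ hyU)).of_le (by simp)).norm_sq ℝ)))
      refine h1.congr_of_eventuallyEq ?_
      filter_upwards [e.open_target.mem_nhds (hetarget ▸ hyU)] with w hw
      simp only [g, if_pos (hetarget ▸ hw)]
    · exact contDiffAt_const.congr_of_eventuallyEq
        (hgconst y fun hyK => hyU (image_mono hKU hyK))
  have hgc : HasCompactSupport g := by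
    refine HasCompactSupport.intro (hbd.isCompact_closure.union hφK) fun y hy => ?_
    rw [mem_union, not_or] at hy
    rw [hgD y hy.2, indicator_of_notMem fun hyD => hy.1 (subset_closure hyD)]
  have hg0 : ∀ y ∉ φ '' U, fderiv ℝ g y = 0 := fun y hy => by
    rw [(hgconst y fun hyK => hy (image_mono hKU hyK)).fderiv_eq, fderiv_const_apply]
  have hgint := integral_eq_of_comp_radial hn hφ hτ hτ1 hτ0 hKU hg hgc hgφ hg0
  let σ : R2n n → ℝ := fun z => τ (‖z‖ ^ 2)
  have hσint : Integrable σ := by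
    refine Continuous.integrable_of_hasCompactSupport (hτ.continuous.comp (by fun_prop)) ?_
    refine HasCompactSupport.intro (isCompact_norm_sq_mem_Icc 0 (r ^ 2 + ε / 2))
      fun z hz => hτ0 _ ?_
    by_contra! hlt
    exact hz ⟨by positivity, hlt.le⟩
  have hσU : ∀ z ∉ U, (ball (0 : R2n n) r).indicator 1 z - σ z = 0 := fun z hz => by
    have hzK : z ∉ K := fun h => hz (hKU h)
    simp only [hK, mem_ofPred_eq, mem_Icc, not_and_or, not_le] at hzK
    rcases hzK with hlt | hlt
    · have : z ∈ ball (0 : R2n n) r := mem_ball_zero_iff.mpr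
        (lt_of_pow_lt_pow_left₀ 2 hr.le (by linarith))
      simp [σ, hτ1 _ hlt.le, this]
    · have : z ∉ ball (0 : R2n n) r := fun h => by
        have := pow_lt_pow_left₀ (mem_ball_zero_iff.mp h) (norm_nonneg z) two_ne_zero
        linarith
      simp [σ, hτ0 _ hlt.le, this]
  have hDint : Integrable (D.indicator (1 : R2n n → ℝ)) :=
    (integrable_indicator_iff hDopen.measurableSet).mpr
      (integrableOn_const hbd.measure_lt_top.ne)
  have hBint : Integrable ((ball (0 : R2n n) r).indicator (1 : R2n n → ℝ)) :=
    (integrable_indicator_iff measurableSet_ball).mpr (integrableOn_const measure_ball_lt_top.ne)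
  have hgi : Integrable g := hg.continuous.integrable_of_hasCompactSupport hgc
  have hsphere : ∀ᵐ z : R2n n, z ∉ sphere (0 : R2n n) r :=
    measure_eq_zero_iff_ae_notMem.mp (Measure.addHaar_sphere_of_ne_zero _ _ hr.ne')
  have hdiff : ∫ y, (D.indicator (1 : R2n n → ℝ) y - g y) =
      (a - b) * ∫ z, ((ball (0 : R2n n) r).indicator (1 : R2n n → ℝ) z - σ z) := by
    rw [← setIntegral_eq_integral_of_forall_compl_eq_zero (s := φ '' U) (fun y hy => by
        rw [hgD y fun hyK => hy (image_mono hKU hyK), sub_self]),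
      integral_image_eq_integral_abs_det_fderiv_smul volume hU.measurableSet
        (fun z hz => (((hφs.contDiffAt (hU.mem_nhds hz)).differentiableAt
          (by simp)).hasFDerivAt).hasFDerivWithinAt) hinj,
      ← setIntegral_eq_integral_of_forall_compl_eq_zero hσU, ← integral_const_mul]
    refine setIntegral_congr_ae hU.measurableSet ?_
    filter_upwards [hsphere] with z hzS hzU
    rw [hdet z hzU, one_smul, hgφ z hzU]
    rw [mem_sphere_zero_iff_norm] at hzS
    rcases lt_or_gt_of_ne hzS with hlt | hlt
    · rw [ha z hzU hlt, indicator_of_mem (mem_ball_zero_iff.mpr hlt)]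
      simp [σ]; ring
    · rw [hb z hzU hlt, indicator_of_notMem fun h => (mem_ball_zero_iff.mp h).not_gt hlt]
      simp [σ]
  rw [integral_sub hDint hgi, integral_sub hBint hσint, hgint,
    integral_indicator_one hDopen.measurableSet, integral_indicator_one measurableSet_ball] at hdiff
  linarith

end Helicity

/-- Helicity lemma: if `φ` is a symplectic embedding of a neighbourhood of the sphere
`S_r^(2n-1)` into `ℝ^(2n)` and `D` is a bounded connected component of the complement of
`S = φ(S_r^(2n-1))`, then `vol(D) = vol(B_r) = πⁿ r^(2n)/n!`. -/
theorem helicity_lemma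
    (n : ℕ) (hn : 2 ≤ n) (r : ℝ) (hr : 0 < r)
    (N : Set (R2n n)) (φ : R2n n → R2n n)
    (hN : sphere (0 : R2n n) r ⊆ N)
    (hφ : IsSympEmbOn n N univ φ)
    (D : Set (R2n n)) (x : R2n n)
    (hx : x ∈ (φ '' sphere (0 : R2n n) r)ᶜ)
    (hD : D = connectedComponentIn (φ '' sphere (0 : R2n n) r)ᶜ x)
    (hbd : IsBounded D) :
    volume D = volume (ball (0 : R2n n) r) ∧
      volume (ball (0 : R2n n) r) = ENNReal.ofReal (π ^ n * r ^ (2 * n) / n.factorial) := by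
  refine ⟨?_, volume_ball_R2n hn hr⟩
  obtain ⟨hNo, hφs, hinj, -, hsymp⟩ := hφ
  obtain ⟨ε, hε, hεr, hUN⟩ := exists_shell_subset hr hNo hN
  let U : Set (R2n n) := {z | ‖z‖ ^ 2 ∈ Ioo (r ^ 2 - ε) (r ^ 2 + ε)}
  have hU : IsSympEmbOn n U univ φ := ⟨isOpen_Ioo.preimage (by fun_prop), hφs.mono hUN,
    hinj.mono hUN, mapsTo_univ _ _, fun p hp => hsymp p (hUN hp)⟩
  have hoff : ∀ z ∈ N, ‖z‖ ≠ r → φ z ∈ (φ '' sphere (0 : R2n n) r)ᶜ := by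
    rintro z hz hzr ⟨w, hw, hwz⟩
    rw [← hinj (hN hw) hz hwz] at hzr
    exact hzr (mem_sphere_zero_iff_norm.mp hw)
  have hpiece : ∀ I : Set ℝ, IsPreconnected I → I ⊆ Ioo (r ^ 2 - ε) (r ^ 2 + ε) → r ^ 2 ∉ I →
      ∃ a : ℝ, (a = 0 ∨ a = 1) ∧ ∀ z : R2n n, ‖z‖ ^ 2 ∈ I →
        D.indicator (1 : R2n n → ℝ) (φ z) = a := by
    intro I hI hIU hrI
    have hsub : {z : R2n n | ‖z‖ ^ 2 ∈ I} ⊆ N := fun z hz => hUN (hIU hz)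
    have hpre := (isPreconnected_norm_sq_mem (one_lt_rank_R2n hn) hI fun s hs => by
      have := (hIU hs).1
      exact mem_Ioi.mpr (by linarith)).image φ (hφs.continuousOn.mono hsub)
    obtain ⟨a, ha, hconst⟩ := exists_indicator_eq_of_isPreconnected
      (O := (φ '' sphere (0 : R2n n) r)ᶜ) hpre (by
        rintro _ ⟨z, hz, rfl⟩
        exact hoff z (hsub hz) fun h => hrI (h ▸ hz)) x
    exact ⟨a, ha, fun z hz => hD ▸ hconst _ (mem_image_of_mem φ hz)⟩
  obtain ⟨a, ha01, ha⟩ := hpiece (Ioo (r ^ 2 - ε) (r ^ 2)) isPreconnected_Ioo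
    (Ioo_subset_Ioo_right (by linarith)) (by simp)
  obtain ⟨b, hb01, hb⟩ := hpiece (Ioo (r ^ 2) (r ^ 2 + ε)) isPreconnected_Ioo
    (Ioo_subset_Ioo_left (by linarith)) (by simp)
  have hjump := volume_component_eq_jump_mul hn hr hε rfl hU rfl hD hbd
    (fun z hz hzr => ha z ⟨hz.1, pow_lt_pow_left₀ hzr (norm_nonneg z) two_ne_zero⟩)
    (fun z hz hzr => hb z ⟨pow_lt_pow_left₀ hzr hr.le two_ne_zero, hz.2⟩)
  have hSclosed : IsClosed (φ '' sphere (0 : R2n n) r) :=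
    ((isCompact_sphere _ _).image_of_continuousOn (hφs.continuousOn.mono hN)).isClosed
  have hDopen : IsOpen D := hD ▸ hSclosed.isOpen_compl.connectedComponentIn
  have hDpos : 0 < volume.real D := ENNReal.toReal_pos
    (hDopen.measure_pos volume ⟨x, hD ▸ mem_connectedComponentIn hx⟩).ne' hbd.measure_lt_top.ne
  have hBnonneg : 0 ≤ volume.real (ball (0 : R2n n) r) := measureReal_nonneg
  have hab : a - b = 1 := by
    rcases ha01 with rfl | rfl <;> rcases hb01 with rfl | rfl <;> norm_num at hjump ⊢ <;> linarith
  rw [hab, one_mul] at hjump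
  exact (measureReal_eq_measureReal_iff hbd.measure_lt_top.ne measure_ball_lt_top.ne).mp hjump
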